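/- arXiv:2512.08993 — 10 statements merged into one kernel-verified Lean document; each statement's English description precedes it below -/
import Mathlib

section
/- Let −π/2 < α < π/2 and 0 ≤ β < 1, and let f ∈ SP⁰_α(β). Then for all z ∈ 𝔻, Re(1 + (1/2)((e^{2iα} − 2β e^{iα} cos α) + 1) · z f″(z)/f′(z)) ≥ 1 − (1−β)² cos²α + ((1 − |z|²)/4) |z f″(z)/f′(z)|². -/
/-- For `f ∈ SP⁰_α(β)` and `z ∈ 𝔻`,
`Re (1 + ½((e^{2iα} − 2β e^{iα} cos α) + 1) · z f″(z)/f′(z))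
  ≥ 1 − (1−β)² cos²α + ((1 − |z|²)/4)|z f″(z)/f′(z)|²`. -/
theorem stmt1 (α β : ℝ) (hα₁ : -(Real.pi / 2) < α) (hα₂ : α < Real.pi / 2)
    (hβ₁ : 0 ≤ β) (hβ₂ : β < 1) (f : ℂ → ℂ)
    (hf : DifferentiableOn ℂ f (Metric.ball 0 1))
    (hf0 : f 0 = 0) (hf1 : deriv f 0 = 1) (hf2 : deriv (deriv f) 0 = 0)
    (hf' : ∀ z ∈ Metric.ball (0 : ℂ) 1, deriv f z ≠ 0)
    (hsp : ∀ z ∈ Metric.ball (0 : ℂ) 1,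
      β * Real.cos α <
        (Complex.exp (Complex.I * (α : ℂ)) *
          (1 + z * deriv (deriv f) z / deriv f z)).re) :
    ∀ z ∈ Metric.ball (0 : ℂ) 1,
      1 - (1 - β) ^ 2 * (Real.cos α) ^ 2 +
          ((1 - ‖z‖ ^ 2) / 4) * ‖z * deriv (deriv f) z / deriv f z‖ ^ 2 ≤
        (1 + (1 / 2 : ℂ) *
            ((Complex.exp (2 * Complex.I * (α : ℂ)) -
                2 * (β : ℂ) * Complex.exp (Complex.I * (α : ℂ)) * (Real.cos α : ℂ)) + 1) *
            (z * deriv (deriv f) z / deriv f z)).re := by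
  intro z hz
  set c : ℝ := (1 - β) * Real.cos α with hc
  have hcos : 0 < Real.cos α := Real.cos_pos_of_mem_Ioo ⟨by linarith, hα₂⟩
  have hcpos : 0 < c := mul_pos (by linarith) hcos
  set e : ℂ := Complex.exp (Complex.I * (α : ℂ)) with he
  have here : e.re = Real.cos α := by rw [he, mul_comm, Complex.exp_ofReal_mul_I_re]
  have heim : e.im = Real.sin α := by rw [he, mul_comm, Complex.exp_ofReal_mul_I_im]
  have henorm : ‖e‖ = 1 := by rw [he, mul_comm, Complex.norm_exp_ofReal_mul_I]
  set W : ℂ → ℂ := fun z => e * (z * deriv (deriv f) z / deriv f z) with hW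
  have hre : ∀ z ∈ Metric.ball (0 : ℂ) 1, -c < (W z).re := by
    intro z hz
    have h := hsp z hz
    rw [mul_add, Complex.add_re, mul_one, here] at h
    simp only [hW, hc]
    linarith
  have hns : ∀ w : ℂ, ‖2 * (c : ℂ) + w‖ ^ 2 = ‖w‖ ^ 2 + (4 * c ^ 2 + 4 * c * w.re) := by
    intro w
    rw [Complex.sq_norm, Complex.sq_norm, Complex.normSq_apply, Complex.normSq_apply]
    simp
    ring
  have hlt : ∀ z ∈ Metric.ball (0 : ℂ) 1, ‖W z‖ < ‖2 * (c : ℂ) + W z‖ := by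
    intro z hz
    refine lt_of_pow_lt_pow_left₀ 2 (norm_nonneg _) ?_
    rw [hns]
    nlinarith [hre z hz, mul_pos hcpos (by linarith [hre z hz] : 0 < c + (W z).re)]
  have hpos : ∀ z ∈ Metric.ball (0 : ℂ) 1, 0 < ‖2 * (c : ℂ) + W z‖ := fun z hz =>
    (norm_nonneg _).trans_lt (hlt z hz)
  have hd1 : DifferentiableOn ℂ (deriv f) (Metric.ball 0 1) := hf.deriv Metric.isOpen_ball
  have hd2 : DifferentiableOn ℂ (deriv (deriv f)) (Metric.ball 0 1) :=
    hd1.deriv Metric.isOpen_ball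
  have hWd : DifferentiableOn ℂ W (Metric.ball 0 1) :=
    ((differentiableOn_id.mul hd2).div hd1 hf').const_mul e
  have hφd : DifferentiableOn ℂ (fun z => W z / (2 * (c : ℂ) + W z)) (Metric.ball 0 1) :=
    hWd.div (hWd.const_add _) (fun z hz => norm_pos_iff.1 (hpos z hz))
  have hmaps : Set.MapsTo (fun z => W z / (2 * (c : ℂ) + W z)) (Metric.ball 0 1)
      (Metric.ball 0 1) := by
    intro z hz
    rw [mem_ball_zero_iff, norm_div, div_lt_one (hpos z hz)]
    exact hlt z hz
  have hz1 : ‖z‖ < 1 := mem_ball_zero_iff.1 hz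
  have hS := Complex.norm_le_norm_of_mapsTo_ball hφd (hmaps.mono_right Metric.ball_subset_closedBall) (by simp [hW]) hz1
  simp only [norm_div] at hS
  rw [div_le_iff₀ (hpos z hz)] at hS
  have hS2 := pow_le_pow_left₀ (norm_nonneg _) hS 2
  rw [mul_pow, hns] at hS2
  have hWn : ‖z * deriv (deriv f) z / deriv f z‖ = ‖W z‖ := by
    simp only [hW]
    rw [norm_mul, henorm, one_mul]
  have hexp2 : Complex.exp (2 * Complex.I * (α : ℂ)) = e * e := by
    rw [he, ← Complex.exp_add]
    congr 1
    ring
  have hone : (1 : ℂ) = e * Complex.exp (-(Complex.I * (α : ℂ))) := by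
    rw [he, ← Complex.exp_add]
    simp
  have hsum : e + Complex.exp (-(Complex.I * (α : ℂ))) = 2 * (Real.cos α : ℂ) := by
    rw [Complex.ofReal_cos, Complex.cos, he, mul_comm Complex.I]
    ring_nf
  have hkey : (1 + (1 / 2 : ℂ) * ((Complex.exp (2 * Complex.I * (α : ℂ)) -
                2 * (β : ℂ) * e * (Real.cos α : ℂ)) + 1) *
            (z * deriv (deriv f) z / deriv f z)) = 1 + (c : ℂ) * W z := by
    have h2 : (Complex.exp (2 * Complex.I * (α : ℂ)) -
        2 * (β : ℂ) * e * (Real.cos α : ℂ)) + 1 = 2 * (c : ℂ) * e := by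
      rw [hexp2, hc]
      push_cast at hsum ⊢
      linear_combination hone + e * hsum
    rw [h2]
    simp only [hW]
    ring
  rw [hkey, hWn, Complex.add_re, Complex.re_ofReal_mul, Complex.one_re, ← mul_pow, ← hc]
  have hp : 0 < c * (c + (W z).re) := mul_pos hcpos (by linarith [hre z hz])
  have hr : ‖z‖ ^ 2 ≤ 1 := pow_le_one₀ (norm_nonneg _) hz1.le
  nlinarith [mul_nonneg (sub_nonneg.2 hr) hp.le]
end

section
/- Let −π/2 < α < π/2 and 0 ≤ β < 1, and let f ∈ SP⁰_α(β). Then for all z ∈ 𝔻, |(1 − |z|²) f″(z)/f′(z) − 2(1−β) e^{−iα} cos α · z̄| ≤ 2(1−β) cos α, where z̄ denotes the complex conjugate of z. -/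
/-- For `f ∈ SP⁰_α(β)` and `z ∈ 𝔻`,
`|(1 − |z|²) f″(z)/f′(z) − 2(1−β)e^{−iα} cos α · conj z| ≤ 2(1−β) cos α`. -/
theorem stmt2 (α β : ℝ) (hα₁ : -(Real.pi / 2) < α) (hα₂ : α < Real.pi / 2)
    (hβ₁ : 0 ≤ β) (hβ₂ : β < 1) (f : ℂ → ℂ)
    (hf : DifferentiableOn ℂ f (Metric.ball 0 1))
    (hf0 : f 0 = 0) (hf1 : deriv f 0 = 1) (hf2 : deriv (deriv f) 0 = 0)
    (hf' : ∀ z ∈ Metric.ball (0 : ℂ) 1, deriv f z ≠ 0)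
    (hsp : ∀ z ∈ Metric.ball (0 : ℂ) 1,
      β * Real.cos α <
        (Complex.exp (Complex.I * (α : ℂ)) *
          (1 + z * deriv (deriv f) z / deriv f z)).re) :
    ∀ z ∈ Metric.ball (0 : ℂ) 1,
      ‖((1 - ‖z‖ ^ 2 : ℝ) : ℂ) * (deriv (deriv f) z / deriv f z) -
          2 * (1 - (β : ℂ)) * Complex.exp (-(Complex.I * (α : ℂ))) * (Real.cos α : ℂ) *
            (starRingEnd ℂ z)‖ ≤ 2 * (1 - β) * Real.cos α := by
  have hO : IsOpen (Metric.ball (0 : ℂ) 1) := Metric.isOpen_ball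
  have hcos : 0 < Real.cos α := Real.cos_pos_of_mem_Ioo ⟨by linarith, hα₂⟩
  have hd1 := hf.deriv hO
  have hd2 := hd1.deriv hO
  obtain ⟨k, hk⟩ : ∃ k : ℝ, k = (1 - β) * Real.cos α := ⟨_, rfl⟩
  have hkpos : 0 < k := by rw [hk]; exact mul_pos (by linarith) hcos
  obtain ⟨E, hE⟩ : ∃ E : ℂ, E = Complex.exp (Complex.I * (α : ℂ)) := ⟨_, rfl⟩
  have hEre : E.re = Real.cos α := by
    rw [hE, mul_comm, Complex.exp_ofReal_mul_I_re]
  have hEn : ‖E‖ = 1 := by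
    rw [hE, mul_comm, Complex.norm_exp_ofReal_mul_I]
  let q : ℂ → ℂ := fun z => E * (z * (deriv (deriv f) z / deriv f z))
  have hqd : DifferentiableOn ℂ q (Metric.ball 0 1) :=
    (differentiableOn_const E).mul (differentiableOn_id.mul (hd2.div hd1 hf'))
  have hqre : ∀ z ∈ Metric.ball (0 : ℂ) 1, -k < (q z).re := by
    intro z hz
    have h := hsp z hz
    rw [← hE, mul_add, mul_one, Complex.add_re, hEre, mul_div_assoc] at h
    change -k < (E * (z * (deriv (deriv f) z / deriv f z))).re
    rw [hk]; linarith
  have hsq : ∀ z : ℂ, ‖q z + 2 * k‖ ^ 2 = ‖q z‖ ^ 2 + 4 * k * (q z).re + 4 * k ^ 2 := by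
    intro z
    rw [Complex.sq_norm, Complex.sq_norm, Complex.normSq_apply, Complex.normSq_apply]
    simp
    ring
  have hlt : ∀ z ∈ Metric.ball (0 : ℂ) 1, ‖q z‖ < ‖q z + 2 * k‖ := by
    intro z hz
    have h1 := hqre z hz
    have h2 := hsq z
    apply lt_of_pow_lt_pow_left₀ 2 (norm_nonneg _)
    nlinarith [mul_pos hkpos (by linarith : 0 < (q z).re + k)]
  have hne : ∀ z ∈ Metric.ball (0 : ℂ) 1, q z + 2 * k ≠ 0 := by
    intro z hz
    exact norm_pos_iff.1 (lt_of_le_of_lt (norm_nonneg _) (hlt z hz))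
  have hwd : DifferentiableOn ℂ (fun z => q z / (q z + 2 * k)) (Metric.ball 0 1) :=
    hqd.div (hqd.add_const _) hne
  intro z hz
  have hr : ‖z‖ < 1 := by simpa using hz
  have hS : ‖q z / (q z + 2 * k)‖ ≤ ‖z‖ := by
    refine Complex.norm_le_norm_of_mapsTo_ball (R := 1) hwd ?_ (by simp [q]) hr
    intro x hx
    rw [mem_closedBall_zero_iff, norm_div]
    exact div_le_one_of_le₀ (hlt x hx).le (norm_nonneg _)
  rw [norm_div, div_le_iff₀ (norm_pos_iff.2 (hne z hz))] at hS
  have hEinv : Complex.exp (-(Complex.I * (α : ℂ))) = E⁻¹ := by rw [Complex.exp_neg, hE]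
  have hE0 : E ≠ 0 := by rw [hE]; exact Complex.exp_ne_zero _
  rw [hEinv]
  have hk2 : 2 * (1 - β) * Real.cos α = 2 * k := by rw [hk]; ring
  rw [hk2]
  by_cases hz0 : z = 0
  · subst hz0
    simp [hf2]
    linarith
  have hrpos : 0 < ‖z‖ := norm_pos_iff.2 hz0
  refine le_of_mul_le_mul_left ?_ hrpos
  have key : ‖(((1 - ‖z‖ ^ 2 : ℝ) : ℂ) * q z - ((2 * k * ‖z‖ ^ 2 : ℝ) : ℂ))‖ ≤ ‖z‖ * (2 * k) := by
    refine (pow_le_pow_iff_left₀ (norm_nonneg _) (by positivity) two_ne_zero).1 ?_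
    have h1 : ‖q z‖ ^ 2 ≤ ‖z‖ ^ 2 * ‖q z + 2 * k‖ ^ 2 := by
      rw [← mul_pow]; exact pow_le_pow_left₀ (norm_nonneg _) hS 2
    rw [hsq] at h1
    have h2 : ‖(((1 - ‖z‖ ^ 2 : ℝ) : ℂ) * q z - ((2 * k * ‖z‖ ^ 2 : ℝ) : ℂ))‖ ^ 2
        = (1 - ‖z‖ ^ 2) ^ 2 * ‖q z‖ ^ 2
          - 4 * k * ‖z‖ ^ 2 * (1 - ‖z‖ ^ 2) * (q z).re + 4 * k ^ 2 * ‖z‖ ^ 4 := by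
      generalize ‖z‖ = r
      rw [Complex.sq_norm, Complex.sq_norm, Complex.normSq_apply, Complex.normSq_apply,
        Complex.sub_re, Complex.sub_im, Complex.re_ofReal_mul, Complex.im_ofReal_mul,
        Complex.ofReal_re, Complex.ofReal_im]
      ring
    rw [h2]
    have h3 : 0 ≤ 1 - ‖z‖ ^ 2 := by nlinarith
    nlinarith [mul_le_mul_of_nonneg_left h1 h3]
  refine le_trans (le_of_eq ?_) key
  rw [← one_mul ‖z‖, ← hEn, mul_assoc, ← norm_mul, ← norm_mul, hEn, one_mul]
  congr 1
  have hzz : z * (starRingEnd ℂ z) = ((‖z‖ ^ 2 : ℝ) : ℂ) := by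
    rw [Complex.mul_conj, Complex.sq_norm]
  have hkc : (k : ℂ) = (1 - (β : ℂ)) * (Real.cos α : ℂ) := by rw [hk]; push_cast; ring
  have hq : q z = E * (z * (deriv (deriv f) z / deriv f z)) := rfl
  have hEE : E * E⁻¹ = 1 := mul_inv_cancel₀ hE0
  rw [hq, Complex.ofReal_mul (2 * k), ← hzz, Complex.ofReal_mul 2 k, hkc]
  rw [Complex.ofReal_ofNat]
  linear_combination (-2 * (1 - (β : ℂ)) * (Real.cos α : ℂ) * z * (starRingEnd ℂ z)) * hEE
end

section
/- Let f be analytic on the open unit disk 𝔻 with f(0) = 0, f′(0) = 1, f″(0) = 0, f′(z) ≠ 0 for all z ∈ 𝔻, and Re(1 + z f″(z)/f′(z)) > 0 for all z ∈ 𝔻. Then for all z ∈ 𝔻, Re(1 + z f″(z)/f′(z)) ≥ (1/4)(1 − |z|²) |z f″(z)/f′(z)|². -/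
/-- For a normalized convex function `f` with `f″(0) = 0` and `z ∈ 𝔻`,
`Re (1 + z f″(z)/f′(z)) ≥ (1/4)(1 − |z|²)|z f″(z)/f′(z)|²`. -/
theorem stmt3 (f : ℂ → ℂ)
    (hf : DifferentiableOn ℂ f (Metric.ball 0 1))
    (hf0 : f 0 = 0) (hf1 : deriv f 0 = 1) (hf2 : deriv (deriv f) 0 = 0)
    (hf' : ∀ z ∈ Metric.ball (0 : ℂ) 1, deriv f z ≠ 0)
    (hconv : ∀ z ∈ Metric.ball (0 : ℂ) 1,
      0 < (1 + z * deriv (deriv f) z / deriv f z).re) :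
    ∀ z ∈ Metric.ball (0 : ℂ) 1,
      (1 / 4) * (1 - ‖z‖ ^ 2) * ‖z * deriv (deriv f) z / deriv f z‖ ^ 2 ≤
        (1 + z * deriv (deriv f) z / deriv f z).re := by
  have hd1 : DifferentiableOn ℂ (deriv f) (Metric.ball 0 1) := hf.deriv Metric.isOpen_ball
  have hd2 : DifferentiableOn ℂ (deriv (deriv f)) (Metric.ball 0 1) :=
    hd1.deriv Metric.isOpen_ball
  set q : ℂ → ℂ := fun z => z * deriv (deriv f) z / deriv f z with hq
  have hqd : DifferentiableOn ℂ q (Metric.ball 0 1) :=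
    (differentiableOn_id.mul hd2).div hd1 hf'
  have hre : ∀ z ∈ Metric.ball (0 : ℂ) 1, 0 < 1 + (q z).re := by
    intro z hz
    simpa using hconv z hz
  have key : ∀ u : ℂ, ‖u + 2‖ ^ 2 = ‖u‖ ^ 2 + 4 * (1 + u.re) := by
    intro u
    rw [← Complex.normSq_eq_norm_sq, ← Complex.normSq_eq_norm_sq, Complex.normSq_apply,
      Complex.normSq_apply]
    simp
    ring
  have hne : ∀ z ∈ Metric.ball (0 : ℂ) 1, 0 < ‖q z + 2‖ := by
    intro z hz
    have h1 := key (q z)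
    have h2 := hre z hz
    have h3 : 0 < ‖q z + 2‖ ^ 2 := by rw [h1]; positivity
    exact lt_of_le_of_ne (norm_nonneg _) (fun h => by rw [← h] at h3; norm_num at h3)
  have hwd : DifferentiableOn ℂ (fun z => q z / (q z + 2)) (Metric.ball 0 1) :=
    hqd.div (hqd.add_const 2) (fun z hz => norm_pos_iff.1 (hne z hz))
  have hmaps : Set.MapsTo (fun z => q z / (q z + 2)) (Metric.ball 0 1) (Metric.ball 0 1) := by
    intro z hz
    have h1 := key (q z)
    have h2 := hre z hz
    rw [mem_ball_zero_iff, norm_div, div_lt_one (hne z hz)]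
    exact lt_of_pow_lt_pow_left₀ 2 (norm_nonneg _) (by linarith)
  intro z hz
  have hz1 : ‖z‖ < 1 := mem_ball_zero_iff.1 hz
  have hs : ‖q z / (q z + 2)‖ ≤ ‖z‖ :=
    Complex.norm_le_norm_of_mapsTo_ball hwd (hmaps.mono_right Metric.ball_subset_closedBall)
      (by simp [hq]) hz1
  rw [norm_div, div_le_iff₀ (hne z hz)] at hs
  have hs2 : ‖q z‖ ^ 2 ≤ ‖z‖ ^ 2 * ‖q z + 2‖ ^ 2 := by
    rw [← mul_pow]
    exact pow_le_pow_left₀ (norm_nonneg _) hs 2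
  rw [key] at hs2
  have h2 := hre z hz
  have h3 : ‖z‖ ^ 2 ≤ 1 := pow_le_one₀ (norm_nonneg _) hz1.le
  change (1 / 4) * (1 - ‖z‖ ^ 2) * ‖q z‖ ^ 2 ≤ (1 + q z).re
  rw [Complex.add_re, Complex.one_re]
  nlinarith [mul_nonneg (sub_nonneg.2 h3) h2.le]
end

section
/- Let f be analytic on the open unit disk 𝔻 with f(0) = 0, f′(0) = 1, f″(0) = 0, f′(z) ≠ 0 for all z ∈ 𝔻, and Re(1 + z f″(z)/f′(z)) > 0 for all z ∈ 𝔻. Then for all z ∈ 𝔻, |(1 − |z|²) f″(z)/f′(z) − 2 z̄| ≤ 2, where z̄ denotes the complex conjugate of z. -/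
/-- For a normalized convex function `f` with `f″(0) = 0` and `z ∈ 𝔻`,
`|(1 − |z|²) f″(z)/f′(z) − 2 conj z| ≤ 2`. -/
theorem stmt4 (f : ℂ → ℂ)
    (hf : DifferentiableOn ℂ f (Metric.ball 0 1))
    (hf0 : f 0 = 0) (hf1 : deriv f 0 = 1) (hf2 : deriv (deriv f) 0 = 0)
    (hf' : ∀ z ∈ Metric.ball (0 : ℂ) 1, deriv f z ≠ 0)
    (hconv : ∀ z ∈ Metric.ball (0 : ℂ) 1,
      0 < (1 + z * deriv (deriv f) z / deriv f z).re) :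
    ∀ z ∈ Metric.ball (0 : ℂ) 1,
      ‖((1 - ‖z‖ ^ 2 : ℝ) : ℂ) * (deriv (deriv f) z / deriv f z) -
          2 * (starRingEnd ℂ z)‖ ≤ 2 := by
  have hd1 : DifferentiableOn ℂ (deriv f) (Metric.ball 0 1) := hf.deriv Metric.isOpen_ball
  have hd2 : DifferentiableOn ℂ (deriv (deriv f)) (Metric.ball 0 1) :=
    hd1.deriv Metric.isOpen_ball
  obtain ⟨g, hg⟩ : ∃ g : ℂ → ℂ, g = fun z => deriv (deriv f) z / deriv f z := ⟨_, rfl⟩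
  have hgz : ∀ z, deriv (deriv f) z / deriv f z = g z := fun z => by rw [hg]
  have hgd : DifferentiableOn ℂ g (Metric.ball 0 1) := by
    rw [hg]; exact hd2.div hd1 hf'
  have hg0 : g 0 = 0 := by rw [hg]; simp [hf2]
  have hre : ∀ z ∈ Metric.ball (0 : ℂ) 1, -1 < (z * g z).re := by
    intro z hz
    have h := hconv z hz
    rw [mul_div_assoc, hgz, Complex.add_re, Complex.one_re] at h
    linarith
  have hne : ∀ z ∈ Metric.ball (0 : ℂ) 1, 2 + z * g z ≠ 0 := by
    intro z hz h
    have h1 := hre z hz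
    have h2 := congrArg Complex.re h
    rw [Complex.add_re] at h2
    norm_num at h2 h1
    linarith
  have hwd : DifferentiableOn ℂ (fun z => z * g z / (2 + z * g z)) (Metric.ball 0 1) :=
    (differentiableOn_id.mul hgd).div
      ((differentiableOn_const _).add (differentiableOn_id.mul hgd)) hne
  have hmaps : Set.MapsTo (fun z => z * g z / (2 + z * g z)) (Metric.ball 0 1)
      (Metric.closedBall 0 1) := by
    intro z hz
    rw [mem_closedBall_zero_iff]
    have h1 := hre z hz
    simp only [norm_div]
    rw [div_le_one (norm_pos_iff.mpr (hne z hz))]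
    generalize z * g z = u at h1
    rw [← sq_le_sq₀ (norm_nonneg _) (norm_nonneg _), ← Complex.normSq_eq_norm_sq,
      ← Complex.normSq_eq_norm_sq, Complex.normSq_apply, Complex.normSq_apply]
    simp only [Complex.add_re, Complex.add_im, Complex.re_ofNat, Complex.im_ofNat]
    nlinarith
  intro z hz
  rw [hgz]
  have hz1 : ‖z‖ < 1 := mem_ball_zero_iff.mp hz
  have key : ‖g z‖ ≤ ‖2 + z * g z‖ := by
    rcases eq_or_ne z 0 with rfl | hz0
    · simp [hg0]
    · have h := Complex.norm_le_norm_of_mapsTo_ball hwd hmaps (by simp) hz1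
      simp only [norm_div] at h
      rw [div_le_iff₀ (norm_pos_iff.mpr (hne z hz)), norm_mul] at h
      exact le_of_mul_le_mul_left h (norm_pos_iff.mpr hz0)
  generalize g z = w at key
  have hr : z.re * z.re + z.im * z.im < 1 := by
    rw [← Complex.normSq_apply, Complex.normSq_eq_norm_sq]
    nlinarith [norm_nonneg z]
  rw [← sq_le_sq₀ (norm_nonneg _) (norm_nonneg _), ← Complex.normSq_eq_norm_sq,
    ← Complex.normSq_eq_norm_sq, Complex.normSq_apply, Complex.normSq_apply] at key
  rw [← sq_le_sq₀ (norm_nonneg _) (by norm_num), ← Complex.normSq_eq_norm_sq,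
    ← Complex.normSq_eq_norm_sq, Complex.normSq_apply, Complex.normSq_apply]
  simp only [Complex.add_re, Complex.add_im, Complex.sub_re, Complex.sub_im, Complex.mul_re,
    Complex.mul_im, Complex.re_ofNat, Complex.im_ofNat, Complex.conj_re, Complex.conj_im,
    Complex.ofReal_re, Complex.ofReal_im] at key ⊢
  have hm := mul_le_mul_of_nonneg_left key (sub_nonneg.mpr hr.le)
  nlinarith [hm]
end

section
/- Let −π/2 < α < π/2 and 0 ≤ β < 1, and let f ∈ SP⁰_α(β). Then the pre-Schwarzian norm of f satisfies ‖P_f‖ = sup_{z∈𝔻} (1 − |z|²)|f″(z)/f′(z)| ≤ 2(1−β) cos α. -/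
/-- **Pre-Schwarzian norm bound.** For `f ∈ SP⁰_α(β)`,
`‖P_f‖ = sup_{z ∈ 𝔻} (1 − |z|²)|f″(z)/f′(z)| ≤ 2(1−β) cos α`. -/
theorem stmt10 (α β : ℝ) (hα₁ : -(Real.pi / 2) < α) (hα₂ : α < Real.pi / 2)
    (hβ₁ : 0 ≤ β) (hβ₂ : β < 1) (f : ℂ → ℂ)
    (hf : DifferentiableOn ℂ f (Metric.ball 0 1))
    (hf0 : f 0 = 0) (hf1 : deriv f 0 = 1) (hf2 : deriv (deriv f) 0 = 0)
    (hf' : ∀ z ∈ Metric.ball (0 : ℂ) 1, deriv f z ≠ 0)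
    (hsp : ∀ z ∈ Metric.ball (0 : ℂ) 1,
      β * Real.cos α <
        (Complex.exp (Complex.I * (α : ℂ)) *
          (1 + z * deriv (deriv f) z / deriv f z)).re) :
    (⨆ z : Metric.ball (0 : ℂ) 1,
        (1 - ‖(z : ℂ)‖ ^ 2) * ‖deriv (deriv f) (z : ℂ) / deriv f (z : ℂ)‖) ≤
      2 * (1 - β) * Real.cos α := by
  have hopen : IsOpen (Metric.ball (0 : ℂ) 1) := Metric.isOpen_ball
  have h0 : (0 : ℂ) ∈ Metric.ball (0 : ℂ) 1 := Metric.mem_ball_self one_pos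
  have hcos : 0 < Real.cos α := Real.cos_pos_of_mem_Ioo ⟨hα₁, hα₂⟩
  set c : ℝ := (1 - β) * Real.cos α with hc
  have hcpos : 0 < c := mul_pos (by linarith) hcos
  have hd1 : DifferentiableOn ℂ (deriv f) (Metric.ball 0 1) := hf.deriv hopen
  have hd2 : DifferentiableOn ℂ (deriv (deriv f)) (Metric.ball 0 1) := hd1.deriv hopen
  set P : ℂ → ℂ := fun z => deriv (deriv f) z / deriv f z with hP
  have hPd : DifferentiableOn ℂ P (Metric.ball 0 1) := hd2.div hd1 hf'
  have hP0 : P 0 = 0 := by simp [hP, hf2]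
  set e : ℂ := Complex.exp (Complex.I * (α : ℂ)) with he
  have hre : e.re = Real.cos α := by
    rw [he, mul_comm, Complex.exp_ofReal_mul_I_re]
  have hen : ‖e‖ = 1 := by
    rw [he, mul_comm, Complex.norm_exp_ofReal_mul_I]
  set g : ℂ → ℂ := fun z => e * (z * P z) with hg
  have hgre : ∀ z ∈ Metric.ball (0 : ℂ) 1, -c < (g z).re := by
    intro z hz
    have h := hsp z hz
    have h2 : e * (1 + z * deriv (deriv f) z / deriv f z) = e + g z := by
      simp only [hg, hP]; ring
    rw [h2, Complex.add_re, hre] at h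
    rw [hc]; linarith
  have hgd : DifferentiableOn ℂ g (Metric.ball 0 1) :=
    (differentiableOn_id.mul hPd).const_mul e
  have hne : ∀ z ∈ Metric.ball (0 : ℂ) 1, g z + 2 * c ≠ 0 := by
    intro z hz h
    have := congrArg Complex.re h
    simp at this
    linarith [hgre z hz]
  set w : ℂ → ℂ := fun z => g z / (g z + 2 * c) with hw
  have hwd : DifferentiableOn ℂ w (Metric.ball 0 1) :=
    hgd.div (hgd.add_const _) hne
  have hw0 : w 0 = 0 := by simp [hw, hg]
  have hmaps : Set.MapsTo w (Metric.ball 0 1) (Metric.ball (w 0) 1) := by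
    intro z hz
    rw [hw0, mem_ball_zero_iff, hw]
    simp only [norm_div]
    rw [div_lt_one (norm_pos_iff.2 (hne z hz))]
    apply lt_of_pow_lt_pow_left₀ 2 (norm_nonneg _)
    rw [Complex.sq_norm, Complex.sq_norm, Complex.normSq_apply, Complex.normSq_apply]
    simp
    nlinarith [hgre z hz]
  have hlit : (fun x => w x - w 0) =o[nhds 0] (fun x => ‖x - 0‖ ^ 1) := by
    have hPo : P =o[nhds 0] (fun _ => (1 : ℂ)) := by
      rw [Asymptotics.isLittleO_one_iff]
      have := (hPd.differentiableAt (hopen.mem_nhds h0)).continuousAt.tendsto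
      rwa [hP0] at this
    have hq : (fun z => e / (g z + 2 * c)) =O[nhds 0] (fun _ => (1 : ℂ)) := by
      have hcont : ContinuousAt (fun z => e / (g z + 2 * c)) 0 :=
        continuousAt_const.div
          ((hgd.differentiableAt (hopen.mem_nhds h0)).continuousAt.add continuousAt_const)
          (hne 0 h0)
      exact hcont.tendsto.isBigO_one ℂ
    have := (hq.mul_isLittleO hPo).mul_isBigO (Asymptotics.isBigO_refl (fun z : ℂ => z) (nhds 0))
    rw [← Asymptotics.isLittleO_norm_right] at this
    refine this.congr (fun z => ?_) (fun z => ?_)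
    · rw [hw0]; simp only [hw, hg]; ring
    · simp
  have : Nonempty (Metric.ball (0 : ℂ) 1) := ⟨⟨0, h0⟩⟩
  apply ciSup_le
  rintro ⟨z, hz⟩
  change (1 - ‖z‖ ^ 2) * ‖P z‖ ≤ 2 * (1 - β) * Real.cos α
  have hz1 : ‖z‖ < 1 := mem_ball_zero_iff.1 hz
  rw [mul_assoc, ← hc]
  rcases eq_or_ne z 0 with rfl | hz0
  · simp [hP0]; exact hcpos.le
  have hzp : 0 < ‖z‖ := norm_pos_iff.2 hz0
  have hS := Complex.dist_le_mul_div_pow_of_mapsTo_ball_of_isLittleO hwd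
    (hmaps.mono_right Metric.ball_subset_closedBall) hlit hz
  have hwz : ‖w z‖ ≤ ‖z‖ ^ 2 := by
    simpa [hw0] using hS
  have hwn : w z * (g z + 2 * c) = g z := div_mul_cancel₀ _ (hne z hz)
  have hgn : ‖g z‖ = ‖z‖ * ‖P z‖ := by simp [hg, hen]
  have h1 : ‖g z‖ ≤ ‖z‖ ^ 2 * (‖g z‖ + 2 * c) := by
    calc ‖g z‖ = ‖w z‖ * ‖g z + 2 * c‖ := by rw [← norm_mul, hwn]
      _ ≤ ‖z‖ ^ 2 * (‖g z‖ + 2 * c) := by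
        gcongr
        refine (norm_add_le _ _).trans ?_
        simp [abs_of_pos hcpos]
  rw [hgn] at h1
  have h2 : ‖z‖ * ((1 - ‖z‖ ^ 2) * ‖P z‖) ≤ ‖z‖ * (2 * c * ‖z‖) := by nlinarith
  have h3 := le_of_mul_le_mul_left h2 hzp
  nlinarith
end

section
/- Let −π/2 < α < π/2 and 0 ≤ β < 1, and set c = (1−β) cos α. Let f* be the analytic function on 𝔻 with f*(0) = 0 and f*′(z) = (1 − z²)^{−c} (principal branch, so f*′(0) = 1). Then f*″(z)/f*′(z) = 2cz/(1 − z²) for all z ∈ 𝔻, and sup_{z∈𝔻} (1 − |z|²)|f*″(z)/f*′(z)| = 2c = 2(1−β) cos α. -/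
/-- **Sharpness of the pre-Schwarzian norm bound.**
With `c = (1−β) cos α`, the function `f*` on `𝔻` with `f* 0 = 0` and
`f*′(z) = (1 − z²)^{−c}` (principal branch) satisfies
`f*″(z)/f*′(z) = 2cz/(1 − z²)` on `𝔻` and
`sup_{z ∈ 𝔻} (1 − |z|²)|f*″(z)/f*′(z)| = 2c`. -/
theorem stmt11 (α β : ℝ) (hα₁ : -(Real.pi / 2) < α) (hα₂ : α < Real.pi / 2)
    (hβ₁ : 0 ≤ β) (hβ₂ : β < 1) (c : ℝ) (hc : c = (1 - β) * Real.cos α)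
    (f : ℂ → ℂ) (hf : DifferentiableOn ℂ f (Metric.ball 0 1))
    (hf0 : f 0 = 0)
    (hfd : ∀ z ∈ Metric.ball (0 : ℂ) 1, deriv f z = (1 - z ^ 2) ^ (-(c : ℂ))) :
    (∀ z ∈ Metric.ball (0 : ℂ) 1,
        deriv (deriv f) z / deriv f z = 2 * (c : ℂ) * z / (1 - z ^ 2)) ∧
      (⨆ z : Metric.ball (0 : ℂ) 1,
          (1 - ‖(z : ℂ)‖ ^ 2) * ‖deriv (deriv f) (z : ℂ) / deriv f (z : ℂ)‖) =
        2 * (1 - β) * Real.cos α := by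
  have hsq : ∀ z ∈ Metric.ball (0 : ℂ) 1, ‖z ^ 2‖ < 1 := by
    intro z hz
    have hz' : ‖z‖ < 1 := by simpa using hz
    rw [norm_pow]
    nlinarith [norm_nonneg z]
  have hslit : ∀ z ∈ Metric.ball (0 : ℂ) 1, (1 - z ^ 2) ∈ Complex.slitPlane := by
    intro z hz
    left
    have h1 := hsq z hz
    have h2 := Complex.re_le_norm (z ^ 2)
    simp only [Complex.sub_re, Complex.one_re]
    linarith
  have key : ∀ z ∈ Metric.ball (0 : ℂ) 1,
      deriv (deriv f) z / deriv f z = 2 * (c : ℂ) * z / (1 - z ^ 2) := by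
    intro z hz
    have hs := hslit z hz
    have hne : (1 - z ^ 2) ≠ 0 := Complex.slitPlane_ne_zero hs
    have hev : deriv f =ᶠ[nhds z] fun w => (1 - w ^ 2) ^ (-(c : ℂ)) :=
      Filter.eventuallyEq_of_mem (Metric.isOpen_ball.mem_nhds hz) hfd
    have hd0 : HasDerivAt (fun w : ℂ => 1 - w ^ 2) (-(2 * z)) z := by
      have := (hasDerivAt_pow 2 z).const_sub 1
      simpa using this
    have hd := hd0.cpow_const (c := -(c : ℂ)) hs
    rw [hev.deriv_eq, hd.deriv, hfd z hz, Complex.cpow_sub _ _ hne, Complex.cpow_one]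
    have hp : (1 - z ^ 2) ^ (-(c : ℂ)) ≠ 0 := by
      simp [Complex.cpow_eq_zero_iff, hne]
    field_simp
  refine ⟨key, ?_⟩
  have hc0 : 0 ≤ c := by
    rw [hc]
    exact mul_nonneg (by linarith) (Real.cos_nonneg_of_mem_Icc ⟨by linarith, by linarith⟩)
  have hgoal : 2 * (1 - β) * Real.cos α = 2 * c := by rw [hc]; ring
  rw [hgoal]
  have hval : ∀ z ∈ Metric.ball (0 : ℂ) 1,
      ‖deriv (deriv f) z / deriv f z‖ = 2 * c * ‖z‖ / ‖1 - z ^ 2‖ := by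
    intro z hz
    rw [key z hz]
    simp [abs_of_nonneg hc0]
  have hle : ∀ z : Metric.ball (0 : ℂ) 1,
      (1 - ‖(z : ℂ)‖ ^ 2) * ‖deriv (deriv f) (z : ℂ) / deriv f (z : ℂ)‖ ≤ 2 * c := by
    rintro ⟨z, hz⟩
    have hz' : ‖z‖ < 1 := by simpa using hz
    have hpos : 0 < ‖1 - z ^ 2‖ := norm_pos_iff.mpr (Complex.slitPlane_ne_zero (hslit z hz))
    have h1 : 1 - ‖z‖ ^ 2 ≤ ‖1 - z ^ 2‖ := by
      have := norm_sub_norm_le (1 : ℂ) (z ^ 2)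
      simpa using this
    simp only
    rw [hval z hz, ← mul_div_assoc, div_le_iff₀ hpos]
    have h2 : 2 * c * ‖z‖ ≤ 2 * c := by nlinarith [norm_nonneg z]
    have h3 : 0 ≤ 2 * c * ‖z‖ := by positivity
    calc (1 - ‖z‖ ^ 2) * (2 * c * ‖z‖) ≤ ‖1 - z ^ 2‖ * (2 * c * ‖z‖) := by gcongr
      _ ≤ ‖1 - z ^ 2‖ * (2 * c) := by gcongr
      _ = 2 * c * ‖1 - z ^ 2‖ := by ring
  have hreal : ∀ r : ℝ, 0 ≤ r → r < 1 → 2 * c * r ≤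
      ⨆ z : Metric.ball (0 : ℂ) 1,
          (1 - ‖(z : ℂ)‖ ^ 2) * ‖deriv (deriv f) (z : ℂ) / deriv f (z : ℂ)‖ := by
    intro r hr0 hr1
    have hz : (r : ℂ) ∈ Metric.ball (0 : ℂ) 1 := by simpa [abs_of_nonneg hr0] using hr1
    refine le_trans (le_of_eq ?_)
      (le_ciSup (⟨2 * c, by rintro _ ⟨z, rfl⟩; exact hle z⟩) (⟨(r : ℂ), hz⟩ : Metric.ball (0 : ℂ) 1))
    have hpos : 0 < 1 - r ^ 2 := by nlinarith
    have hn : ‖(1 : ℂ) - (r : ℂ) ^ 2‖ = 1 - r ^ 2 := by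
      have : (1 : ℂ) - (r : ℂ) ^ 2 = ((1 - r ^ 2 : ℝ) : ℂ) := by push_cast; ring
      rw [this, Complex.norm_real, Real.norm_of_nonneg hpos.le]
    simp only
    rw [hval _ hz, hn, Complex.norm_real, Real.norm_of_nonneg hr0]
    field_simp
  haveI : Nonempty (Metric.ball (0 : ℂ) 1) := ⟨⟨0, by simp⟩⟩
  apply le_antisymm (ciSup_le hle)
  have ht : Filter.Tendsto (fun r : ℝ => 2 * c * r) (nhdsWithin 1 (Set.Iio 1)) (nhds (2 * c * 1)) :=
    ((continuous_const.mul continuous_id).tendsto 1).mono_left nhdsWithin_le_nhds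
  rw [mul_one] at ht
  refine le_of_tendsto ht ?_
  filter_upwards [Ioo_mem_nhdsLT (show (0 : ℝ) < 1 by norm_num)] with r hr
  exact hreal r hr.1.le hr.2
end

section
/- Let f be analytic on the open unit disk 𝔻 with f(0) = 0, f′(0) = 1, f″(0) = 0, f′(z) ≠ 0 for all z ∈ 𝔻, and Re(1 + z f″(z)/f′(z)) > 0 for all z ∈ 𝔻. Then sup_{z∈𝔻} (1 − |z|²)|f″(z)/f′(z)| ≤ 2. -/
/-- For a normalized convex function `f` with `f″(0) = 0`,
`sup_{z ∈ 𝔻} (1 − |z|²)|f″(z)/f′(z)| ≤ 2`. -/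
theorem stmt12 (f : ℂ → ℂ)
    (hf : DifferentiableOn ℂ f (Metric.ball 0 1))
    (hf0 : f 0 = 0) (hf1 : deriv f 0 = 1) (hf2 : deriv (deriv f) 0 = 0)
    (hf' : ∀ z ∈ Metric.ball (0 : ℂ) 1, deriv f z ≠ 0)
    (hconv : ∀ z ∈ Metric.ball (0 : ℂ) 1,
      0 < (1 + z * deriv (deriv f) z / deriv f z).re) :
    (⨆ z : Metric.ball (0 : ℂ) 1,
        (1 - ‖(z : ℂ)‖ ^ 2) * ‖deriv (deriv f) (z : ℂ) / deriv f (z : ℂ)‖) ≤ 2 := by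
  have h1 : DifferentiableOn ℂ (deriv f) (Metric.ball 0 1) := hf.deriv Metric.isOpen_ball
  have h2 : DifferentiableOn ℂ (deriv (deriv f)) (Metric.ball 0 1) :=
    h1.deriv Metric.isOpen_ball
  set P : ℂ → ℂ := fun z => deriv (deriv f) z / deriv f z with hP
  have hPd : DifferentiableOn ℂ P (Metric.ball 0 1) := h2.div h1 hf'
  have hP0 : P 0 = 0 := by simp [hP, hf2]
  have hre : ∀ z ∈ Metric.ball (0 : ℂ) 1, 0 < 1 + (z * P z).re := by
    intro z hz
    have := hconv z hz
    rw [mul_div_assoc] at this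
    simpa only [Complex.add_re, Complex.one_re] using this
  have hne : ∀ z ∈ Metric.ball (0 : ℂ) 1, z * P z + 2 ≠ 0 := by
    intro z hz h
    have h3 := hre z hz
    have h4 := congrArg Complex.re h
    simp only [Complex.add_re, Complex.re_ofNat, Complex.zero_re] at h4
    linarith
  set w : ℂ → ℂ := fun z => z * P z / (z * P z + 2) with hw
  have hwd : DifferentiableOn ℂ w (Metric.ball 0 1) :=
    (differentiableOn_id.mul hPd).div ((differentiableOn_id.mul hPd).add_const 2) hne
  have hw0 : w 0 = 0 := by simp [hw]
  have hmaps : Set.MapsTo w (Metric.ball 0 1) (Metric.ball (w 0) 1) := by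
    intro z hz
    rw [hw0, mem_ball_zero_iff, hw]
    simp only [norm_div]
    rw [div_lt_one (norm_pos_iff.2 (hne z hz))]
    apply lt_of_pow_lt_pow_left₀ 2 (norm_nonneg _)
    have h3 := hre z hz
    generalize z * P z = q at *
    rw [Complex.sq_norm, Complex.sq_norm, Complex.normSq_apply, Complex.normSq_apply]
    simp only [Complex.add_re, Complex.re_ofNat, Complex.add_im, Complex.im_ofNat]
    nlinarith
  have h0mem : Metric.ball (0 : ℂ) 1 ∈ nhds (0 : ℂ) := Metric.ball_mem_nhds _ one_pos
  have hlo : (fun z => w z - w 0) =o[nhds 0] fun z => ‖z - 0‖ ^ 1 := by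
    have hc : ContinuousAt (fun z => P z / (z * P z + 2)) 0 := by
      have := (hPd.differentiableAt h0mem).continuousAt
      exact this.div ((continuousAt_id.mul this).add continuousAt_const) (hne 0 (by simp))
    have ht : Filter.Tendsto (fun z => P z / (z * P z + 2)) (nhds 0) (nhds 0) := by
      have := hc.tendsto
      simpa [hP0] using this
    have h5 := ((Asymptotics.isLittleO_one_iff ℂ).2 ht).mul_isBigO
      (Asymptotics.isBigO_refl (fun z : ℂ => z) (nhds 0))
    have h6 : (fun z => w z - w 0) =o[nhds 0] fun z : ℂ => z := by
      refine (h5.congr_left ?_).congr_right ?_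
      · intro z; rw [hw0]; simp only [hw]; ring
      · intro z; simp
    simpa using h6.norm_right
  have : Nonempty (Metric.ball (0 : ℂ) 1) := ⟨⟨0, by simp⟩⟩
  apply ciSup_le
  rintro ⟨z, hz⟩
  change (1 - ‖z‖ ^ 2) * ‖P z‖ ≤ 2
  have hz1 : ‖z‖ < 1 := by simpa using hz
  have key : ‖w z‖ ≤ ‖z‖ ^ 2 := by
    have := Complex.dist_le_mul_div_pow_of_mapsTo_ball_of_isLittleO hwd
      (hmaps.mono_right Metric.ball_subset_closedBall) hlo hz
    simpa [hw0] using this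
  rcases eq_or_ne z 0 with rfl | hz0
  · simp [hP0]
  have hzp : 0 < ‖z‖ := norm_pos_iff.2 hz0
  have h7 : ‖z * P z‖ ≤ ‖z‖ ^ 2 * (‖z * P z‖ + 2) := by
    have h8 : z * P z = w z * (z * P z + 2) := by
      simp only [hw]; rw [div_mul_cancel₀ _ (hne z hz)]
    calc ‖z * P z‖ = ‖w z‖ * ‖z * P z + 2‖ := by rw [← norm_mul, ← h8]
      _ ≤ ‖z‖ ^ 2 * (‖z * P z‖ + 2) := by
        gcongr
        exact (norm_add_le _ _).trans (by simp)
  rw [norm_mul] at h7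
  have h9 : ‖z‖ * ((1 - ‖z‖ ^ 2) * ‖P z‖) ≤ ‖z‖ * (2 * ‖z‖) := by nlinarith
  have := le_of_mul_le_mul_left h9 hzp
  linarith
end

section
/- Let f be analytic on the open unit disk 𝔻 with f(0) = 0, f′(0) = 1, f″(0) = 0, f′(z) ≠ 0 for all z ∈ 𝔻, and Re(1 + z f″(z)/f′(z)) > 0 for all z ∈ 𝔻. Then sup_{z∈𝔻} (1 − |z|²)² |S_f(z)| ≤ 2, where S_f = (f″/f′)′ − (1/2)(f″/f′)². -/
theorem aux_norm_sq (a w : ℂ) :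
    ‖1 + (starRingEnd ℂ) a * w‖ ^ 2 - ‖w + a‖ ^ 2 = (1 - ‖a‖ ^ 2) * (1 - ‖w‖ ^ 2) := by
  simp only [Complex.sq_norm, Complex.normSq_apply, Complex.add_re, Complex.add_im,
    Complex.mul_re, Complex.mul_im, Complex.conj_re, Complex.conj_im, Complex.one_re,
    Complex.one_im]
  ring

theorem aux_ne (a w : ℂ) (ha : ‖a‖ < 1) (hw : ‖w‖ ≤ 1) :
    1 + (starRingEnd ℂ) a * w ≠ 0 := by
  intro h
  have h1 : (starRingEnd ℂ) a * w = -1 := by linear_combination h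
  have h2 : ‖a‖ * ‖w‖ = 1 := by
    have := congrArg norm h1
    simpa using this
  nlinarith [norm_nonneg a, norm_nonneg w]

theorem aux_le (a w : ℂ) (ha : ‖a‖ < 1) (hw : ‖w‖ ≤ 1) :
    ‖(w + a) / (1 + (starRingEnd ℂ) a * w)‖ ≤ 1 := by
  rw [norm_div, div_le_one (norm_pos_iff.2 (aux_ne a w ha hw))]
  have h := aux_norm_sq a w
  have h1 : 0 ≤ (1 - ‖a‖ ^ 2) * (1 - ‖w‖ ^ 2) := by
    apply mul_nonneg <;> nlinarith [norm_nonneg a, norm_nonneg w]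
  exact (sq_le_sq₀ (norm_nonneg _) (norm_nonneg _)).1 (by linarith)

theorem aux_lt (a w : ℂ) (ha : ‖a‖ < 1) (hw : ‖w‖ < 1) :
    ‖(w + a) / (1 + (starRingEnd ℂ) a * w)‖ < 1 := by
  rw [norm_div, div_lt_one (norm_pos_iff.2 (aux_ne a w ha hw.le))]
  have h := aux_norm_sq a w
  have h1 : 0 < (1 - ‖a‖ ^ 2) * (1 - ‖w‖ ^ 2) := by
    apply mul_pos <;> nlinarith [norm_nonneg a, norm_nonneg w]
  exact lt_of_pow_lt_pow_left₀ 2 (norm_nonneg _) (by linarith)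

/-- Schwarz-Pick, derivative form. -/
theorem aux_pick (φ : ℂ → ℂ) (hφ : DifferentiableOn ℂ φ (Metric.ball 0 1))
    (hm : ∀ z ∈ Metric.ball (0 : ℂ) 1, ‖φ z‖ < 1) (a : ℂ) (ha : a ∈ Metric.ball (0 : ℂ) 1) :
    ‖deriv φ a‖ * (1 - ‖a‖ ^ 2) ≤ 1 - ‖φ a‖ ^ 2 := by
  have ha' : ‖a‖ < 1 := by simpa using ha
  have hb := hm a ha
  set b := φ a with hbdef
  have hbn : ‖-b‖ < 1 := by simpa using hb
  let T : ℂ → ℂ := fun w => (w + a) / (1 + (starRingEnd ℂ) a * w)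
  let B : ℂ → ℂ := fun w => (w + -b) / (1 + (starRingEnd ℂ) (-b) * w)
  have hTm : Set.MapsTo T (Metric.ball 0 1) (Metric.ball 0 1) := by
    intro w hw
    have hw' : ‖w‖ < 1 := by simpa using hw
    exact mem_ball_zero_iff.2 (aux_lt a w ha' hw')
  have hBm : Set.MapsTo B (Metric.ball 0 1) (Metric.ball 0 1) := by
    intro w hw
    have hw' : ‖w‖ < 1 := by simpa using hw
    exact mem_ball_zero_iff.2 (aux_lt (-b) w hbn hw')
  have hφm : Set.MapsTo φ (Metric.ball 0 1) (Metric.ball 0 1) := by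
    intro w hw
    simpa using hm w hw
  have key : ∀ c w : ℂ, ‖c‖ < 1 → ‖w‖ < 1 →
      HasDerivAt (fun w => (w + c) / (1 + (starRingEnd ℂ) c * w))
        ((1 * (1 + (starRingEnd ℂ) c * w) - (w + c) * ((starRingEnd ℂ) c * 1)) /
          (1 + (starRingEnd ℂ) c * w) ^ 2) w := by
    intro c w hc hw
    exact ((hasDerivAt_id w).add_const c).div
      (((hasDerivAt_id w).const_mul ((starRingEnd ℂ) c)).const_add 1) (aux_ne c w hc hw.le)
  have hTd : DifferentiableOn ℂ T (Metric.ball 0 1) := fun w hw =>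
    (key a w ha' (by simpa using hw)).differentiableAt.differentiableWithinAt
  have hBd : DifferentiableOn ℂ B (Metric.ball 0 1) := fun w hw =>
    (key (-b) w hbn (by simpa using hw)).differentiableAt.differentiableWithinAt
  have hT0 : T 0 = a := by simp [T]
  have hB0 : B b = 0 := by simp [B]
  have hGd : DifferentiableOn ℂ (B ∘ φ ∘ T) (Metric.ball 0 1) :=
    hBd.comp (hφ.comp hTd hTm) (hφm.comp hTm)
  have hG0 : (B ∘ φ ∘ T) 0 = 0 := by simp [hT0, ← hbdef, hB0]
  have hle := Complex.norm_deriv_le_one_of_mapsTo_ball hGd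
    (by rw [hG0]; exact fun w hw => Metric.ball_subset_closedBall (hBm (hφm (hTm hw)))) one_pos
  have hT' : HasDerivAt T (1 - (‖a‖ : ℂ) ^ 2) 0 := by
    have := key a 0 ha' (by simp)
    convert this using 1
    simp [Complex.mul_conj']
  have hφ' : HasDerivAt φ (deriv φ a) (T 0) := by
    rw [hT0]
    exact (hφ.differentiableAt (Metric.isOpen_ball.mem_nhds ha)).hasDerivAt
  have hne : (1 - (‖b‖ : ℂ) ^ 2) ≠ 0 := by
    have : (1 - ‖b‖ ^ 2 : ℝ) ≠ 0 := by nlinarith [norm_nonneg b]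
    exact_mod_cast this
  have hB' : HasDerivAt B (1 / (1 - (‖b‖ : ℂ) ^ 2)) (φ (T 0)) := by
    rw [hT0, ← hbdef]
    have := key (-b) b hbn hb
    convert this using 1
    have h2 : (starRingEnd ℂ) b * b = (‖b‖ : ℂ) ^ 2 := Complex.conj_mul' b
    have h3 : 1 + (starRingEnd ℂ) (-b) * b = 1 - (‖b‖ : ℂ) ^ 2 := by
      rw [map_neg, neg_mul, h2]; ring
    rw [h3]
    field_simp
    ring
  have hG' := (hB'.comp (0 : ℂ) (hφ'.comp (0 : ℂ) hT')).deriv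
  rw [hG'] at hle
  have e1 : (1 - (‖a‖ : ℂ) ^ 2) = ((1 - ‖a‖ ^ 2 : ℝ) : ℂ) := by push_cast; rfl
  have e2 : (1 - (‖b‖ : ℂ) ^ 2) = ((1 - ‖b‖ ^ 2 : ℝ) : ℂ) := by push_cast; rfl
  have p1 : 0 < 1 - ‖a‖ ^ 2 := by nlinarith [norm_nonneg a]
  have p2 : 0 < 1 - ‖b‖ ^ 2 := by nlinarith [norm_nonneg b]
  rw [e1, e2, norm_mul, norm_mul, norm_div, norm_one, Complex.norm_of_nonneg p1.le,
    Complex.norm_of_nonneg p2.le, div_mul_eq_mul_div, one_mul, div_le_one p2] at hle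
  exact hle

/-- For a normalized convex function `f` with `f″(0) = 0`,
`sup_{z ∈ 𝔻} (1 − |z|²)²|S_f(z)| ≤ 2`, where `S_f = (f″/f′)′ − ½ (f″/f′)²`. -/
theorem stmt14 (f : ℂ → ℂ)
    (hf : DifferentiableOn ℂ f (Metric.ball 0 1))
    (hf0 : f 0 = 0) (hf1 : deriv f 0 = 1) (hf2 : deriv (deriv f) 0 = 0)
    (hf' : ∀ z ∈ Metric.ball (0 : ℂ) 1, deriv f z ≠ 0)
    (hconv : ∀ z ∈ Metric.ball (0 : ℂ) 1,
      0 < (1 + z * deriv (deriv f) z / deriv f z).re) :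
    (⨆ z : Metric.ball (0 : ℂ) 1,
        (1 - ‖(z : ℂ)‖ ^ 2) ^ 2 *
          ‖deriv (fun w => deriv (deriv f) w / deriv f w) (z : ℂ) -
            (1 / 2 : ℂ) * (deriv (deriv f) (z : ℂ) / deriv f (z : ℂ)) ^ 2‖) ≤ 2 := by
  have hU : IsOpen (Metric.ball (0 : ℂ) 1) := Metric.isOpen_ball
  have hd1 := hf.deriv hU
  have hd2 := hd1.deriv hU
  let P : ℂ → ℂ := fun w => deriv (deriv f) w / deriv f w
  have hP : DifferentiableOn ℂ P (Metric.ball 0 1) := hd2.div hd1 hf'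
  have hre : ∀ z ∈ Metric.ball (0 : ℂ) 1, 0 < 1 + (z * P z).re := by
    intro z hz
    have := hconv z hz
    rw [mul_div_assoc] at this
    simpa [P] using this
  have hDne : ∀ z ∈ Metric.ball (0 : ℂ) 1, 2 + z * P z ≠ 0 := by
    intro z hz h
    have h1 := hre z hz
    have h2 := congrArg Complex.re h
    rw [Complex.add_re] at h2
    norm_num at h2 h1
    linarith
  let φ : ℂ → ℂ := fun w => P w / (2 + w * P w)
  have hφ : DifferentiableOn ℂ φ (Metric.ball 0 1) :=
    hP.div ((differentiableOn_const 2).add (differentiableOn_id.mul hP)) hDne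
  have hφ0 : φ 0 = 0 := by simp [φ, P, hf2]
  have hω : ∀ z ∈ Metric.ball (0 : ℂ) 1, ‖z * φ z‖ ≤ 1 := by
    intro z hz
    have h1 := hre z hz
    have : z * φ z = (z * P z) / (2 + z * P z) := by simp [φ, mul_div_assoc]
    rw [this, norm_div, div_le_one (norm_pos_iff.2 (hDne z hz))]
    generalize z * P z = q at h1
    refine (sq_le_sq₀ (norm_nonneg _) (norm_nonneg _)).1 ?_
    simp only [Complex.sq_norm, Complex.normSq_apply, Complex.add_re, Complex.add_im,
      Complex.re_ofNat, Complex.im_ofNat]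
    nlinarith
  have hωs : ∀ z ∈ Metric.ball (0 : ℂ) 1, ‖z * φ z‖ ≤ ‖z‖ := by
    intro z hz
    refine Complex.norm_le_norm_of_mapsTo_ball (f := fun z => z * φ z) (R := 1)
      (differentiableOn_id.mul hφ) ?_ (by simp) (by simpa using hz)
    intro w hw
    simpa using hω w hw
  have hφ1 : ∀ z ∈ Metric.ball (0 : ℂ) 1, ‖φ z‖ ≤ 1 := by
    intro z hz
    rcases eq_or_ne z 0 with rfl | h0
    · simp [hφ0]
    · have h := hωs z hz
      rw [norm_mul] at h
      have h0' : 0 < ‖z‖ := norm_pos_iff.2 h0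
      nlinarith
  have hφs : ∀ z ∈ Metric.ball (0 : ℂ) 1, ‖φ z‖ < 1 := by
    intro z hz
    have hz' : ‖z‖ < 1 := by simpa using hz
    refine lt_of_le_of_lt (Complex.norm_le_norm_of_mapsTo_ball hφ ?_ hφ0 hz') hz'
    intro w hw
    simpa using hφ1 w hw
  have : Nonempty (Metric.ball (0 : ℂ) 1) := ⟨⟨0, by simp⟩⟩
  refine ciSup_le ?_
  rintro ⟨z, hz⟩
  have hz' : ‖z‖ < 1 := by simpa using hz
  have hpick := aux_pick φ hφ hφs z hz
  have hPd : HasDerivAt P (deriv P z) z := (hP.differentiableAt (hU.mem_nhds hz)).hasDerivAt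
  have hφd := (hPd.div (((hasDerivAt_id z).mul hPd).const_add 2) (hDne z hz)).deriv
  have hD := hDne z hz
  change (1 - ‖z‖ ^ 2) ^ 2 * ‖deriv P z - (1 / 2 : ℂ) * (P z) ^ 2‖ ≤ 2
  have hS : deriv P z - (1 / 2 : ℂ) * (P z) ^ 2 = deriv φ z * (2 + z * P z) ^ 2 / 2 := by
    have : deriv φ z = (deriv P z * (2 + z * P z) - P z * (1 * P z + z * deriv P z)) /
      (2 + z * P z) ^ 2 := hφd
    rw [this, div_mul_cancel₀ _ (pow_ne_zero 2 hD)]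
    ring
  have hprod : (1 - z * φ z) * (2 + z * P z) = 2 := by
    simp only [φ]
    field_simp
    ring
  have hprodn : ‖1 - z * φ z‖ * ‖2 + z * P z‖ = 2 := by
    rw [← norm_mul, hprod]; simp
  have hid : (1 - ‖z‖ ^ 2) * (1 - ‖φ z‖ ^ 2) ≤ ‖1 - z * φ z‖ ^ 2 := by
    have h := aux_norm_sq (-(starRingEnd ℂ) z) (φ z)
    simp only [map_neg, Complex.conj_conj, norm_neg, RCLike.norm_conj, neg_mul,
      ← sub_eq_add_neg] at h
    nlinarith [sq_nonneg ‖φ z - (starRingEnd ℂ) z‖]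
  have p1 : 0 < 1 - ‖z‖ ^ 2 := by nlinarith [norm_nonneg z]
  rw [hS, norm_div, norm_mul, norm_pow, Complex.norm_ofNat]
  calc (1 - ‖z‖ ^ 2) ^ 2 * (‖deriv φ z‖ * ‖2 + z * P z‖ ^ 2 / 2)
      = (1 - ‖z‖ ^ 2) * (‖deriv φ z‖ * (1 - ‖z‖ ^ 2)) * (‖2 + z * P z‖ ^ 2 / 2) := by ring
    _ ≤ (1 - ‖z‖ ^ 2) * (1 - ‖φ z‖ ^ 2) * (‖2 + z * P z‖ ^ 2 / 2) := by gcongr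
    _ ≤ ‖1 - z * φ z‖ ^ 2 * (‖2 + z * P z‖ ^ 2 / 2) := by gcongr
    _ = (‖1 - z * φ z‖ * ‖2 + z * P z‖) ^ 2 / 2 := by ring
    _ = 2 := by rw [hprodn]; norm_num
end

section
/- Let −π/2 < α < π/2 and 0 ≤ β < 1, and set c = (1−β) cos α. Let f* be the analytic function on 𝔻 with f*(0) = 0 and f*′(z) = (1 − z²)^{−c} (principal branch). Then its Schwarzian derivative is S_{f*}(z) = 2c(1 + (1 − c)z²)/(1 − z²)² for all z ∈ 𝔻, and sup_{z∈𝔻} (1 − |z|²)² |S_{f*}(z)| = 2c(2 − c). -/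
/-- **Sharpness of the Schwarzian norm bound.**
With `c = (1−β) cos α`, the function `f*` on `𝔻` with `f* 0 = 0` and
`f*′(z) = (1 − z²)^{−c}` (principal branch) has Schwarzian derivative
`S_{f*}(z) = 2c(1 + (1 − c)z²)/(1 − z²)²` on `𝔻`, and
`sup_{z ∈ 𝔻} (1 − |z|²)²|S_{f*}(z)| = 2c(2 − c)`. -/
theorem stmt15 (α β : ℝ) (hα₁ : -(Real.pi / 2) < α) (hα₂ : α < Real.pi / 2)
    (hβ₁ : 0 ≤ β) (hβ₂ : β < 1) (c : ℝ) (hc : c = (1 - β) * Real.cos α)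
    (f : ℂ → ℂ) (hf : DifferentiableOn ℂ f (Metric.ball 0 1))
    (hf0 : f 0 = 0)
    (hfd : ∀ z ∈ Metric.ball (0 : ℂ) 1, deriv f z = (1 - z ^ 2) ^ (-(c : ℂ))) :
    (∀ z ∈ Metric.ball (0 : ℂ) 1,
        deriv (fun w => deriv (deriv f) w / deriv f w) z -
            (1 / 2 : ℂ) * (deriv (deriv f) z / deriv f z) ^ 2 =
          2 * (c : ℂ) * (1 + (1 - (c : ℂ)) * z ^ 2) / (1 - z ^ 2) ^ 2) ∧
      (⨆ z : Metric.ball (0 : ℂ) 1,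
          (1 - ‖(z : ℂ)‖ ^ 2) ^ 2 *
            ‖deriv (fun w => deriv (deriv f) w / deriv f w) (z : ℂ) -
              (1 / 2 : ℂ) * (deriv (deriv f) (z : ℂ) / deriv f (z : ℂ)) ^ 2‖) =
        2 * c * (2 - c) := by
  have hc0 : 0 < c := by
    rw [hc]
    exact mul_pos (by linarith) (Real.cos_pos_of_mem_Ioo ⟨by linarith, hα₂⟩)
  have hc1 : c ≤ 1 := by
    rw [hc]
    have h1 := Real.cos_le_one α
    have h2 : 0 < Real.cos α := Real.cos_pos_of_mem_Ioo ⟨by linarith, hα₂⟩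
    nlinarith
  have hsl : ∀ z ∈ Metric.ball (0 : ℂ) 1, (1 - z ^ 2) ∈ Complex.slitPlane := by
    intro z hz
    have hz1 : ‖z‖ < 1 := by simpa using hz
    have h2 : ‖-z ^ 2‖ < 1 := by
      rw [norm_neg, norm_pow]
      nlinarith [norm_nonneg z]
    have := Complex.mem_slitPlane_of_norm_lt_one h2
    rwa [sub_eq_add_neg]
  have hne : ∀ z ∈ Metric.ball (0 : ℂ) 1, (1 - z ^ 2) ≠ 0 := fun z hz =>
    Complex.slitPlane_ne_zero (hsl z hz)
  have hev : ∀ z ∈ Metric.ball (0 : ℂ) 1, ∀ᶠ w in nhds z, w ∈ Metric.ball (0 : ℂ) 1 :=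
    fun z hz => Metric.isOpen_ball.mem_nhds hz
  have hin : ∀ z : ℂ, HasDerivAt (fun w : ℂ => 1 - w ^ 2) (-(2 * z)) z := by
    intro z
    simpa using ((hasDerivAt_pow 2 z).const_sub 1)
  have hd2 : ∀ z ∈ Metric.ball (0 : ℂ) 1,
      deriv (deriv f) z / deriv f z = 2 * (c : ℂ) * z / (1 - z ^ 2) := by
    intro z hz
    have he : deriv f =ᶠ[nhds z] fun w => (1 - w ^ 2) ^ (-(c : ℂ)) := by
      filter_upwards [hev z hz] with w hw using hfd w hw
    have hd := (hin z).cpow_const (c := -(c : ℂ)) (hsl z hz)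
    rw [he.deriv_eq, hd.deriv, hfd z hz, Complex.cpow_sub _ _ (hne z hz), Complex.cpow_one]
    have h0 := hne z hz
    have h3 : (1 - z ^ 2) ^ (-(c : ℂ)) ≠ 0 := by
      rw [Complex.cpow_ne_zero_iff]
      exact Or.inl h0
    generalize (1 - z ^ 2) ^ (-(c : ℂ)) = p at h3 ⊢
    field_simp
  have hS : ∀ z ∈ Metric.ball (0 : ℂ) 1,
        deriv (fun w => deriv (deriv f) w / deriv f w) z -
            (1 / 2 : ℂ) * (deriv (deriv f) z / deriv f z) ^ 2 =
          2 * (c : ℂ) * (1 + (1 - (c : ℂ)) * z ^ 2) / (1 - z ^ 2) ^ 2 := by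
    intro z hz
    have he : (fun w => deriv (deriv f) w / deriv f w) =ᶠ[nhds z]
        fun w => 2 * (c : ℂ) * w / (1 - w ^ 2) := by
      filter_upwards [hev z hz] with w hw using hd2 w hw
    have h0 := hne z hz
    have hd := ((hasDerivAt_id z).const_mul (2 * (c : ℂ))).div (hin z) h0
    have hd' : deriv (fun w => 2 * (c : ℂ) * w / (1 - w ^ 2)) z = _ := hd.deriv
    rw [he.deriv_eq, hd', hd2 z hz]
    simp only [id]
    field_simp
    ring
  refine ⟨hS, ?_⟩
  have hcn : ‖(1 - (c : ℂ))‖ = 1 - c := by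
    have : (1 - (c : ℂ)) = ((1 - c : ℝ) : ℂ) := by push_cast; ring
    rw [this, Complex.norm_real, Real.norm_of_nonneg (by linarith)]
  haveI : Nonempty (Metric.ball (0 : ℂ) 1) := ⟨⟨0, by simp⟩⟩
  refine ciSup_eq_of_forall_le_of_forall_lt_exists_gt ?_ ?_
  · rintro ⟨z, hz⟩
    simp only
    rw [hS z hz]
    have hz1 : ‖z‖ < 1 := by simpa using hz
    have hz0 := norm_nonneg z
    have hzz : ‖z‖ ^ 2 < 1 := by nlinarith
    have hA : 1 - ‖z‖ ^ 2 ≤ ‖1 - z ^ 2‖ := by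
      have := norm_sub_norm_le (1 : ℂ) (z ^ 2)
      simpa using this
    have hB : ‖1 + (1 - (c : ℂ)) * z ^ 2‖ ≤ 2 - c := by
      refine (norm_add_le _ _).trans ?_
      rw [norm_mul, hcn, norm_pow, norm_one]
      nlinarith
    have hP : 0 < ‖1 - z ^ 2‖ := norm_pos_iff.mpr (hne z hz)
    rw [norm_div, norm_mul, norm_mul, norm_pow, Complex.norm_real,
      Real.norm_of_nonneg hc0.le, Complex.norm_two, mul_div_assoc', div_le_iff₀ (by positivity)]
    have hA2 : (1 - ‖z‖ ^ 2) ^ 2 ≤ ‖1 - z ^ 2‖ ^ 2 :=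
      pow_le_pow_left₀ (by linarith) hA 2
    calc (1 - ‖z‖ ^ 2) ^ 2 * (2 * c * ‖1 + (1 - (c : ℂ)) * z ^ 2‖)
        ≤ ‖1 - z ^ 2‖ ^ 2 * (2 * c * (2 - c)) := by gcongr
      _ = _ := by ring
  · intro w hw
    have hcont : Continuous (fun x : ℝ => 2 * c * (1 + (1 - c) * x ^ 2)) := by fun_prop
    have ht : Filter.Tendsto (fun x : ℝ => 2 * c * (1 + (1 - c) * x ^ 2))
        (nhdsWithin 1 (Set.Iio 1)) (nhds (2 * c * (1 + (1 - c) * 1 ^ 2))) :=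
      (hcont.tendsto 1).mono_left nhdsWithin_le_nhds
    have h1 := ht.eventually (lt_mem_nhds (a := w) (by linarith))
    have h2 : ∀ᶠ x : ℝ in nhdsWithin 1 (Set.Iio 1), x ∈ Set.Ioo (0 : ℝ) 1 :=
      Ioo_mem_nhdsLT one_pos
    obtain ⟨x, hx1, hx0, hx2⟩ := (h1.and h2).exists
    have hxb : (x : ℂ) ∈ Metric.ball (0 : ℂ) 1 := by
      rw [mem_ball_zero_iff, Complex.norm_real, Real.norm_of_nonneg hx0.le]
      exact hx2
    refine ⟨⟨(x : ℂ), hxb⟩, ?_⟩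
    simp only
    rw [hS _ hxb]
    have hX : 0 < 1 - x ^ 2 := by nlinarith
    have hc2 : 0 ≤ 1 - c := by linarith
    have hr : 2 * (c : ℂ) * (1 + (1 - (c : ℂ)) * (x : ℂ) ^ 2) / (1 - (x : ℂ) ^ 2) ^ 2
        = ((2 * c * (1 + (1 - c) * x ^ 2) / (1 - x ^ 2) ^ 2 : ℝ) : ℂ) := by
      push_cast
      ring
    rw [hr, Complex.norm_real, Complex.norm_real, Real.norm_of_nonneg hx0.le,
      Real.norm_of_nonneg (by positivity), mul_div_cancel₀ _ (by positivity)]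
    exact hx1
end

section
/- Let −π/2 < α < π/2, 0 ≤ β < 1, set c = (1−β) cos α, and let A ∈ (1, 2] be a real constant. For f ∈ SP⁰_α(β) define T_f(z) = (2/(A−1)) · ((A+1)/2 · (1+z)/(1−z) − 1 − z f″(z)/f′(z)) and Φ_A(r) = (A + 1 − 2c) r² − 2(A + 1 + c) r + (A − 1) for r ∈ [0,1]. Then for every z ∈ 𝔻 with Φ_A(|z|) > 0 one has Re(T_f(z)) > 0; in particular, Re(T_f(z)) > 0 whenever |z| < R, where R is the smallest root of Φ_A in (0,1). -/
lemma aux_bound (h : ℂ → ℂ) (e : ℂ) (c : ℝ) (hc : 0 < c) (he : ‖e‖ = 1)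
    (hd : DifferentiableOn ℂ h (Metric.ball 0 1)) (h0 : h 0 = 0)
    (hre : ∀ z ∈ Metric.ball (0 : ℂ) 1, -c < (e * (z * h z)).re)
    (z : ℂ) (hz : z ∈ Metric.ball (0 : ℂ) 1) :
    ‖z * h z‖ * (1 - ‖z‖ ^ 2) ≤ 2 * c * ‖z‖ ^ 2 := by
  have hne : ∀ z ∈ Metric.ball (0 : ℂ) 1, e * (z * h z) + 2 * (c : ℂ) ≠ 0 := by
    intro z hz H
    have h1 := congrArg Complex.re H
    have h2 := hre z hz
    have h3 : (e * (z * h z)).re + 2 * c = 0 := by simpa using h1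
    linarith
  set k : ℂ → ℂ := fun z => e * h z / (e * (z * h z) + 2 * (c : ℂ)) with hk
  have hkd : DifferentiableOn ℂ k (Metric.ball 0 1) := by
    apply DifferentiableOn.div _ _ hne <;> fun_prop
  set w : ℂ → ℂ := fun z => z * k z with hw
  have hwd : DifferentiableOn ℂ w (Metric.ball 0 1) := by fun_prop
  have hw0 : w 0 = 0 := by simp [hw]
  have hwe : ∀ z, w z = e * (z * h z) / (e * (z * h z) + 2 * (c : ℂ)) := by
    intro z; simp only [hw, hk]; ring
  have hmaps : Set.MapsTo w (Metric.ball 0 1) (Metric.closedBall (w 0) 1) := by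
    intro x hx
    rw [hw0, mem_closedBall_zero_iff, hwe, norm_div]
    apply div_le_one_of_le₀ _ (norm_nonneg _)
    have h2 := hre x hx
    generalize e * (x * h x) = g at h2
    rw [← sq_le_sq₀ (by positivity) (by positivity), Complex.sq_norm, Complex.sq_norm,
      Complex.normSq_apply, Complex.normSq_apply]
    simp
    nlinarith
  have hlo : (fun x => w x - w 0) =o[nhds 0] (fun x : ℂ => ‖x - 0‖ ^ 1) := by
    have hk0 : Filter.Tendsto k (nhds 0) (nhds 0) := by
      have := (hkd.continuousOn.continuousAt (Metric.ball_mem_nhds (0 : ℂ) one_pos)).tendsto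
      simpa [hk, h0] using this
    have := (Asymptotics.isBigO_refl (fun x : ℂ => x) (nhds 0)).mul_isLittleO
      ((Asymptotics.isLittleO_one_iff ℂ).2 hk0)
    simp only [hw0, sub_zero, pow_one]
    exact (by simpa using this : w =o[nhds 0] (fun x : ℂ => x)).norm_right
  have key := Complex.dist_le_mul_div_pow_of_mapsTo_ball_of_isLittleO hwd hmaps hlo hz
  rw [hw0, dist_zero_right, dist_zero_right, hwe, norm_div,
    div_le_iff₀ (norm_pos_iff.2 (hne z hz))] at key
  have h4 : ‖e * (z * h z) + 2 * (c : ℂ)‖ ≤ ‖z * h z‖ + 2 * c := by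
    refine (norm_add_le _ _).trans ?_
    rw [norm_mul e, he]
    simp [abs_of_pos hc]
  rw [norm_mul e, he] at key
  norm_num at key
  rw [norm_mul] at h4 ⊢
  nlinarith [mul_le_mul_of_nonneg_left h4 (sq_nonneg ‖z‖)]

lemma aux_re (z : ℂ) (hz : ‖z‖ < 1) :
    (1 - ‖z‖) / (1 + ‖z‖) ≤ ((1 + z) / (1 - z)).re := by
  have h1 : ((1 + z) / (1 - z)).re = (1 - ‖z‖ ^ 2) / ‖1 - z‖ ^ 2 := by
    rw [Complex.div_re, ← add_div, Complex.sq_norm, Complex.sq_norm]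
    congr 1
    simp [Complex.normSq_apply]; ring
  have h2 : ‖1 - z‖ ≤ 1 + ‖z‖ := by simpa using norm_sub_le (1 : ℂ) z
  have h3 : 0 < ‖1 - z‖ := by
    have : 1 - ‖z‖ ≤ ‖1 - z‖ := by simpa using norm_sub_norm_le (1 : ℂ) z
    linarith
  have h0 := norm_nonneg z
  rw [h1, div_le_div_iff₀ (by positivity) (by positivity)]
  have : ‖1 - z‖ ^ 2 ≤ (1 + ‖z‖) ^ 2 := by gcongr
  nlinarith [mul_le_mul_of_nonneg_left this (sub_nonneg.2 hz.le)]


/-- **Radius of concavity.** For `f ∈ SP⁰_α(β)`, `c = (1−β) cos α`,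
`A ∈ (1, 2]`, with
`T_f(z) = (2/(A−1))((A+1)/2 · (1+z)/(1−z) − 1 − z f″(z)/f′(z))` and
`Φ_A(r) = (A+1−2c)r² − 2(A+1+c)r + (A−1)`:
for every `z ∈ 𝔻` with `Φ_A(|z|) > 0` one has `Re (T_f z) > 0`; in particular
`Re (T_f z) > 0` whenever `|z| < R`, where `R` is the smallest root of `Φ_A` in `(0,1)`. -/
theorem stmt19 (α β : ℝ) (hα₁ : -(Real.pi / 2) < α) (hα₂ : α < Real.pi / 2)
    (hβ₁ : 0 ≤ β) (hβ₂ : β < 1) (c : ℝ) (hc : c = (1 - β) * Real.cos α)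
    (A : ℝ) (hA₁ : 1 < A) (hA₂ : A ≤ 2) (f : ℂ → ℂ)
    (hf : DifferentiableOn ℂ f (Metric.ball 0 1))
    (hf0 : f 0 = 0) (hf1 : deriv f 0 = 1) (hf2 : deriv (deriv f) 0 = 0)
    (hf' : ∀ z ∈ Metric.ball (0 : ℂ) 1, deriv f z ≠ 0)
    (hsp : ∀ z ∈ Metric.ball (0 : ℂ) 1,
      β * Real.cos α <
        (Complex.exp (Complex.I * (α : ℂ)) *
          (1 + z * deriv (deriv f) z / deriv f z)).re)
    (T : ℂ → ℂ)
    (hT : ∀ z ∈ Metric.ball (0 : ℂ) 1,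
      T z = (2 / ((A : ℂ) - 1)) *
        (((A : ℂ) + 1) / 2 * ((1 + z) / (1 - z)) - 1 -
          z * deriv (deriv f) z / deriv f z))
    (Φ : ℝ → ℝ)
    (hΦ : ∀ r : ℝ, Φ r = (A + 1 - 2 * c) * r ^ 2 - 2 * (A + 1 + c) * r + (A - 1)) :
    (∀ z ∈ Metric.ball (0 : ℂ) 1, 0 < Φ ‖z‖ → 0 < (T z).re) ∧
      (∀ R : ℝ, R ∈ Set.Ioo (0 : ℝ) 1 → Φ R = 0 →
        (∀ r ∈ Set.Ioo (0 : ℝ) 1, Φ r = 0 → R ≤ r) →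
        ∀ z ∈ Metric.ball (0 : ℂ) 1, ‖z‖ < R → 0 < (T z).re) := by
  have hcos : 0 < Real.cos α := Real.cos_pos_of_mem_Ioo ⟨by linarith, hα₂⟩
  have hc0 : 0 < c := by rw [hc]; exact mul_pos (by linarith) hcos
  have hc1 : c ≤ 1 := by rw [hc]; nlinarith [Real.cos_le_one α]
  have main : ∀ z ∈ Metric.ball (0 : ℂ) 1, 0 < Φ ‖z‖ → 0 < (T z).re := by
    intro z hz hp
    have hd1 : DifferentiableOn ℂ (deriv f) (Metric.ball 0 1) := hf.deriv Metric.isOpen_ball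
    have hd2 : DifferentiableOn ℂ (deriv (deriv f)) (Metric.ball 0 1) :=
      hd1.deriv Metric.isOpen_ball
    have hb := aux_bound (fun z => deriv (deriv f) z / deriv f z)
      (Complex.exp (Complex.I * (α : ℂ))) c hc0
      (by rw [mul_comm]; exact Complex.norm_exp_ofReal_mul_I α)
      (hd2.div hd1 hf') (by simp [hf2]) (by
        intro z hz
        have h := hsp z hz
        have h2 : (Complex.exp (Complex.I * (α : ℂ))).re = Real.cos α := by
          rw [mul_comm]; exact Complex.exp_ofReal_mul_I_re α
        rw [mul_add, mul_one, Complex.add_re, h2, mul_div_assoc] at h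
        rw [hc]; linarith) z hz
    have hz1 : ‖z‖ < 1 := by simpa using hz
    have hr := aux_re z hz1
    rw [hT z hz, mul_div_assoc z]
    have hre := Complex.re_le_norm (z * (deriv (deriv f) z / deriv f z))
    generalize z * (deriv (deriv f) z / deriv f z) = p at hb hre
    generalize (1 + z) / (1 - z) = q at hr
    have e1 : (2 / ((A : ℂ) - 1)) * (((A : ℂ) + 1) / 2 * q - 1 - p)
        = ((2 / (A - 1) : ℝ) : ℂ) * ((((A + 1) / 2 : ℝ) : ℂ) * q - 1 - p) := by
      push_cast; ring
    rw [e1, Complex.re_ofReal_mul, Complex.sub_re, Complex.sub_re, Complex.re_ofReal_mul,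
      Complex.one_re]
    apply mul_pos (div_pos two_pos (by linarith))
    have hr0 := norm_nonneg z
    rw [hΦ] at hp
    generalize ‖z‖ = r at *
    rw [div_le_iff₀ (by linarith)] at hr
    have hs : 0 < 1 - r ^ 2 := by nlinarith
    have h5 : p.re * (1 - r ^ 2) ≤ 2 * c * r ^ 2 :=
      (mul_le_mul_of_nonneg_right hre hs.le).trans hb
    have h6 : (1 - r) * (1 - r) ≤ q.re * (1 - r ^ 2) := by
      nlinarith [mul_le_mul_of_nonneg_right hr (by linarith : 0 ≤ 1 - r)]
    have h7 : 0 < ((A + 1) / 2 * q.re - 1 - p.re) * (1 - r ^ 2) := by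
      have := mul_le_mul_of_nonneg_left h6 (by linarith : 0 ≤ (A + 1) / 2)
      have h8 : 0 ≤ (1 - c) * r ^ 2 := mul_nonneg (by linarith) (sq_nonneg r)
      have h9 : 0 ≤ c * r := mul_nonneg hc0.le hr0
      nlinarith
    exact pos_of_mul_pos_left h7 hs.le
  refine ⟨main, fun R hR hR0 hmin z hz hzR => main z hz ?_⟩
  by_contra hneg
  push Not at hneg
  have hcont : Continuous Φ := by
    have : Φ = fun r => (A + 1 - 2 * c) * r ^ 2 - 2 * (A + 1 + c) * r + (A - 1) := funext hΦ
    rw [this]; fun_prop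
  have hΦ0 : 0 < Φ 0 := by rw [hΦ]; norm_num; linarith
  obtain ⟨r, hr, hr0⟩ := intermediate_value_Icc' (norm_nonneg z) hcont.continuousOn
    (show (0 : ℝ) ∈ Set.Icc (Φ ‖z‖) (Φ 0) from ⟨hneg, hΦ0.le⟩)
  have hrpos : 0 < r := by
    rcases hr.1.eq_or_lt with h | h
    · rw [← h] at hr0; linarith
    · exact h
  have := hmin r ⟨hrpos, by linarith [hr.2, hR.2]⟩ hr0
  linarith [hr.2]
end
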